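/- arXiv:2602.08486 — 3 statements merged into one kernel-verified Lean document; each statement's English description precedes it below -/
import Mathlib

section
/- Let 0 < Δ < 𝓛, let h > 0 be a fixed bandwidth and K : ℝ → ℝ an L-Lipschitz kernel. For each p, let X_{p,1}, …, X_{p,p} be real random variables and define q̂_p(x) = (ph)⁻¹ Σ_{j=1}^p 1{X_{p,j} ≠ 0}·K((x − X_{p,j})/h). Suppose q : [Δ, 𝓛] → ℝ is uniformly continuous and for every fixed x ∈ [Δ, 𝓛], q̂_p(x) → q(x) in probability as p → ∞. Then sup_{x ∈ [Δ, 𝓛]} |q̂_p(x) − q(x)| → 0 in probability as p → ∞. -/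
open MeasureTheory ProbabilityTheory Filter Set
open scoped Classical ENNReal NNReal Topology

noncomputable section

/-- On a totally bounded set, pointwise convergence in measure of a uniformly equicontinuous
sequence of random functions to a uniformly continuous function is uniform. -/
theorem tendstoInMeasure_iSup_abs_sub {Ω α : Type*} [MeasurableSpace Ω] [PseudoMetricSpace α]
    {P : Measure Ω} {s : Set α} (hs : TotallyBounded s) (hne : s.Nonempty)
    {f : ℕ → α → Ω → ℝ} {q : α → ℝ}
    (hf : ∀ ε > 0, ∃ δ > 0, ∀ n ω, ∀ x ∈ s, ∀ y ∈ s, dist x y < δ →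
      |f n x ω - f n y ω| < ε)
    (hq : UniformContinuousOn q s)
    (hpt : ∀ x ∈ s, TendstoInMeasure P (fun n => f n x) atTop (fun _ => q x)) :
    TendstoInMeasure P (fun n ω => ⨆ x : s, |f n x ω - q x|) atTop (fun _ => (0 : ℝ)) := by
  have : Nonempty s := hne.to_subtype
  rw [tendstoInMeasure_iff_dist]
  intro ε hε
  obtain ⟨δ₁, hδ₁, hf⟩ := hf (ε / 4) (by positivity)
  obtain ⟨δ₂, hδ₂, hq⟩ := Metric.uniformContinuousOn_iff.1 hq (ε / 4) (by positivity)
  obtain ⟨t, hts, htf, hst⟩ :=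
    Metric.finite_approx_of_totallyBounded hs (min δ₁ δ₂) (lt_min hδ₁ hδ₂)
  have hsub : ∀ n, {ω | ε ≤ dist (⨆ x : s, |f n x ω - q x|) 0} ⊆
      ⋃ y ∈ htf.toFinset, {ω | ε / 4 ≤ dist (f n y ω) (q y)} := by
    intro n ω hω
    by_contra hnot
    simp only [mem_iUnion, Set.Finite.mem_toFinset, mem_ofPred_eq, not_exists, not_le] at hnot
    have hle : (⨆ x : s, |f n x ω - q x|) ≤ 3 * (ε / 4) := by
      refine ciSup_le fun x => ?_
      obtain ⟨y, hy, hxy⟩ := mem_iUnion₂.1 (hst x.2)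
      obtain ⟨h₁, h₂⟩ := lt_min_iff.1 (Metric.mem_ball.1 hxy)
      have e₁ := abs_lt.1 (hf n ω x x.2 y (hts hy) h₁)
      have e₂ := hq x x.2 y (hts hy) h₂
      have e₃ := hnot y hy
      rw [Real.dist_eq, abs_lt] at e₂ e₃
      rw [abs_le]
      constructor <;> linarith [e₁.1, e₁.2, e₂.1, e₂.2, e₃.1, e₃.2]
    have h0 : 0 ≤ ⨆ x : s, |f n x ω - q x| := Real.iSup_nonneg fun _ => abs_nonneg _
    rw [mem_ofPred_eq, Real.dist_0_eq_abs, abs_of_nonneg h0] at hω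
    linarith
  have hlim : Tendsto (fun n => ∑ y ∈ htf.toFinset, P {ω | ε / 4 ≤ dist (f n y ω) (q y)})
      atTop (𝓝 0) := by
    rw [← Finset.sum_const_zero (s := htf.toFinset)]
    refine tendsto_finsetSum _ fun y hy => ?_
    exact tendstoInMeasure_iff_dist.1 (hpt y (hts (htf.mem_toFinset.1 hy))) _ (by positivity)
  exact tendsto_of_tendsto_of_tendsto_of_le_of_le tendsto_const_nhds hlim (fun _ => zero_le)
    fun n => (measure_mono (hsub n)).trans (measure_biUnion_finset_le _ _)

/-- A kernel density estimator built from a Lipschitz kernel is Lipschitz, with a constant that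
depends neither on the sample nor on its size. -/
theorem abs_kernelEstimator_sub_le {K : ℝ → ℝ} {C h : ℝ} (hh : 0 < h)
    (hK : ∀ u v : ℝ, |K u - K v| ≤ C * |u - v|) {p : ℕ} (a : Fin p → ℝ) (x y : ℝ) :
    |((p : ℝ) * h)⁻¹ * (∑ j, if a j ≠ 0 then K ((x - a j) / h) else 0) -
      ((p : ℝ) * h)⁻¹ * ∑ j, if a j ≠ 0 then K ((y - a j) / h) else 0| ≤
      C / h ^ 2 * |x - y| := by
  have hC : 0 ≤ C := by simpa using (abs_nonneg _).trans (hK 1 0)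
  rcases Nat.eq_zero_or_pos p with rfl | hp
  · simpa using by positivity
  have hp' : (0 : ℝ) < p := Nat.cast_pos.2 hp
  have hterm : ∀ j, |(if a j ≠ 0 then K ((x - a j) / h) else 0) -
      (if a j ≠ 0 then K ((y - a j) / h) else 0)| ≤ C * (|x - y| / h) := by
    intro j
    split_ifs
    · refine (hK _ _).trans_eq ?_
      rw [← sub_div, sub_sub_sub_cancel_right, abs_div, abs_of_pos hh]
    · simpa using by positivity
  rw [← mul_sub, ← Finset.sum_sub_distrib, abs_mul, abs_of_pos (by positivity)]
  calc _ ≤ ((p : ℝ) * h)⁻¹ * (p * (C * (|x - y| / h))) := by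
        gcongr
        refine (Finset.abs_sum_le_sum_abs _ _).trans ?_
        simpa using Finset.sum_le_sum fun j (_ : j ∈ Finset.univ) => hterm j
    _ = C / h ^ 2 * |x - y| := by field_simp

/-- **Proposition 4.6 (uniform consistency of a kernel density estimator).**
Let `0 < Δ < L`, `h > 0` a fixed bandwidth, `K` an `LK`-Lipschitz kernel and
`q̂_p(x) = (ph)⁻¹ Σⱼ 1{X_{p,j} ≠ 0} K((x - X_{p,j})/h)`. If `q` is uniformly
continuous on `[Δ, L]` and `q̂_p(x) → q(x)` in probability for every fixed
`x ∈ [Δ, L]`, then `sup_{x ∈ [Δ, L]} |q̂_p(x) - q(x)| → 0` in probability. -/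
theorem kde_uniform_consistency
    {Ω : Type*} [MeasurableSpace Ω] (P : Measure Ω) [IsProbabilityMeasure P]
    (Δ L h LK : ℝ) (hΔ : 0 < Δ) (hΔL : Δ < L) (hh : 0 < h)
    (K : ℝ → ℝ) (hK : ∀ u v : ℝ, |K u - K v| ≤ LK * |u - v|)
    (Xseq : (p : ℕ) → Fin p → Ω → ℝ) (hXmeas : ∀ p (j : Fin p), Measurable (Xseq p j))
    (q : ℝ → ℝ) (hq : UniformContinuousOn q (Set.Icc Δ L))
    (qhat : (p : ℕ) → ℝ → Ω → ℝ)
    (hqhat : ∀ (p : ℕ) (x : ℝ) (ω : Ω), qhat p x ω =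
      ((p : ℝ) * h)⁻¹ * ∑ j : Fin p,
        if Xseq p j ω ≠ 0 then K ((x - Xseq p j ω) / h) else 0)
    (hpt : ∀ x ∈ Set.Icc Δ L,
      TendstoInMeasure P (fun (p : ℕ) ω => qhat p x ω) atTop (fun _ => q x)) :
    TendstoInMeasure P
      (fun (p : ℕ) ω => ⨆ x : Set.Icc Δ L, |qhat p (x : ℝ) ω - q (x : ℝ)|)
      atTop (fun _ => (0 : ℝ)) := by
  refine tendstoInMeasure_iSup_abs_sub isCompact_Icc.totallyBounded
    (nonempty_Icc.2 hΔL.le) (fun ε hε => ?_) hq hpt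
  have hLK : 0 ≤ LK := by simpa using (abs_nonneg _).trans (hK 1 0)
  refine ⟨ε / (LK / h ^ 2 + 1), by positivity, fun p ω x _ y _ hxy => ?_⟩
  rw [lt_div_iff₀ (by positivity), Real.dist_eq] at hxy
  rw [hqhat, hqhat]
  refine (abs_kernelEstimator_sub_le hh hK (fun j => Xseq p j ω) x y).trans_lt ?_
  linarith [abs_nonneg (x - y)]

end
end

section
/- Let τ > 0 and m ∈ ℝ, and let τ̂_p and m̂_p be sequences of random variables with τ̂_p → τ and m̂_p → m in probability as p → ∞. Define q̂_{0,p}(x) = τ̂_p⁻¹·φ((x + m̂_p·sign(x))/τ̂_p) and q₀(x) = τ⁻¹·φ((x + m·sign(x))/τ). Then for any 0 < Δ < 𝓛 and I = [−𝓛, −Δ] ∪ [Δ, 𝓛], sup_{x ∈ I} |q̂_{0,p}(x) − q₀(x)| → 0 in probability as p → ∞. -/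
open MeasureTheory ProbabilityTheory Filter Set
open scoped Classical ENNReal NNReal Topology

noncomputable section

/-- Standard normal p.d.f. `φ`. -/
def stdPhi (x : ℝ) : ℝ := (Real.sqrt (2 * Real.pi))⁻¹ * Real.exp (-(x ^ 2) / 2)

theorem continuous_stdPhi : Continuous stdPhi := by
  unfold stdPhi
  fun_prop

/-- Plug-in normal densities depend on the scale and shift uniformly over bounded arguments. -/
theorem eventually_forall_abs_scaled_stdPhi_sub_lt {τ : ℝ} (hτ : 0 < τ) (m L : ℝ) {ε : ℝ}
    (hε : 0 < ε) :
    ∀ᶠ q : ℝ × ℝ in 𝓝 (τ, m), ∀ y ∈ Set.Icc (-L) L ×ˢ Set.Icc (-1 : ℝ) 1,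
      |q.1⁻¹ * stdPhi ((y.1 + q.2 * y.2) / q.1) - τ⁻¹ * stdPhi ((y.1 + m * y.2) / τ)| < ε := by
  have hs : IsOpen (Set.Ioi (0 : ℝ) ×ˢ (Set.univ : Set ℝ)) := isOpen_Ioi.prod isOpen_univ
  have hmem : (τ, m) ∈ Set.Ioi (0 : ℝ) ×ˢ (Set.univ : Set ℝ) := ⟨hτ, trivial⟩
  have hcont : ContinuousOn
      (Function.uncurry fun q y : ℝ × ℝ => q.1⁻¹ * stdPhi ((y.1 + q.2 * y.2) / q.1))
      ((Set.Ioi (0 : ℝ) ×ˢ (Set.univ : Set ℝ)) ×ˢ (Set.Icc (-L) L ×ˢ Set.Icc (-1 : ℝ) 1)) := by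
    have hne : ∀ z ∈ (Set.Ioi (0 : ℝ) ×ˢ (Set.univ : Set ℝ)) ×ˢ
        (Set.Icc (-L) L ×ˢ Set.Icc (-1 : ℝ) 1), z.1.1 ≠ 0 := fun z hz => ne_of_gt hz.1.1
    have hfst : ContinuousOn (fun z : (ℝ × ℝ) × (ℝ × ℝ) => z.1.1)
        ((Set.Ioi (0 : ℝ) ×ˢ (Set.univ : Set ℝ)) ×ˢ
          (Set.Icc (-L) L ×ˢ Set.Icc (-1 : ℝ) 1)) := by fun_prop
    refine (hfst.inv₀ hne).mul (continuous_stdPhi.comp_continuousOn (ContinuousOn.div ?_ hfst hne))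
    fun_prop
  obtain ⟨v, hv, hvu⟩ := (isCompact_Icc.prod isCompact_Icc).mem_uniformity_of_prod hcont hmem
    (Metric.dist_mem_uniformity hε)
  rw [hs.nhdsWithin_eq hmem] at hv
  filter_upwards [hv] with q hq y hy
  simpa [Real.dist_eq] using hvu q hq y hy

theorem abs_sign_le_one (x : ℝ) : |Real.sign x| ≤ 1 := by
  rcases Real.sign_apply_eq x with h | h | h <;> simp [h]

/-- If an event is implied by closeness of `f n` to `a` and of `g n` to `b`, where `f → a` and
`g → b` in measure, then the measure of its complement tends to zero. -/
theorem tendsto_measure_of_eventually_nhds_prod {Ω ι : Type*} [MeasurableSpace Ω] {P : Measure Ω}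
    {l : Filter ι} {f g : ι → Ω → ℝ} {a b : ℝ} (hf : TendstoInMeasure P f l fun _ => a)
    (hg : TendstoInMeasure P g l fun _ => b) {A : ι → Set Ω} {p : ℝ × ℝ → Prop}
    (hp : ∀ᶠ q in 𝓝 (a, b), p q) (hA : ∀ n, ∀ ω ∈ A n, ¬ p (f n ω, g n ω)) :
    Tendsto (fun n => P (A n)) l (𝓝 0) := by
  obtain ⟨δ, hδ, hball⟩ := Metric.eventually_nhds_iff.1 hp
  rw [tendstoInMeasure_iff_dist] at hf hg
  have hsum := (hf δ hδ).add (hg δ hδ)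
  rw [add_zero] at hsum
  refine tendsto_of_tendsto_of_tendsto_of_le_of_le tendsto_const_nhds hsum
    (fun _ => zero_le) fun n => ?_
  refine (measure_mono fun ω hω => ?_).trans (measure_union_le _ _)
  by_contra hcon
  simp only [Set.mem_union, Set.mem_ofPred_eq, not_or, not_le] at hcon
  exact hA n ω hω (hball (max_lt hcon.1 hcon.2))

/-- **Proposition 4.8 (uniform consistency of the plug-in null density estimator).**
If `τ̂_p → τ > 0` and `m̂_p → m` in probability, then the plug-in estimator
`q̂_{0,p}(x) = τ̂_p⁻¹ φ((x + m̂_p sign x)/τ̂_p)` converges to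
`q₀(x) = τ⁻¹ φ((x + m sign x)/τ)` uniformly in probability on
`I = [-L, -Δ] ∪ [Δ, L]`. -/
theorem null_density_uniform_consistency
    {Ω : Type*} [MeasurableSpace Ω] (P : Measure Ω) [IsProbabilityMeasure P]
    (τ m : ℝ) (hτ : 0 < τ)
    (τhat mhat : ℕ → Ω → ℝ)
    (hτhatMeas : ∀ p, Measurable (τhat p)) (hmhatMeas : ∀ p, Measurable (mhat p))
    (hτhat : TendstoInMeasure P τhat atTop (fun _ => τ))
    (hmhat : TendstoInMeasure P mhat atTop (fun _ => m))
    (Δ L : ℝ) (hΔ : 0 < Δ) (hΔL : Δ < L) :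
    TendstoInMeasure P
      (fun (p : ℕ) ω =>
        ⨆ x : (Set.Icc (-L) (-Δ) ∪ Set.Icc Δ L : Set ℝ),
          |(τhat p ω)⁻¹ * stdPhi (((x : ℝ) + mhat p ω * Real.sign (x : ℝ)) / τhat p ω)
            - τ⁻¹ * stdPhi (((x : ℝ) + m * Real.sign (x : ℝ)) / τ)|)
      atTop (fun _ => (0 : ℝ)) := by
  rw [tendstoInMeasure_iff_dist]
  intro ε hε
  refine tendsto_measure_of_eventually_nhds_prod hτhat hmhat
    (eventually_forall_abs_scaled_stdPhi_sub_lt hτ m L (half_pos hε)) fun p ω hω hclose => ?_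
  simp only [Set.mem_ofPred_eq, Real.dist_eq, sub_zero] at hω
  rw [abs_of_nonneg (Real.iSup_nonneg fun _ => abs_nonneg _)] at hω
  refine absurd (hω.trans (Real.iSup_le (fun x => ?_) (half_pos hε).le)) (by linarith)
  have hx : (x : ℝ) ∈ Set.Icc (-L) L := by
    rcases x.2 with h | h
    · exact ⟨h.1, by linarith [h.2]⟩
    · exact ⟨by linarith [h.1], h.2⟩
  exact (hclose (x, Real.sign x) ⟨hx, abs_le.1 (abs_sign_le_one x)⟩).le

end
end

section
/- Let Π = (1−ε)δ₀ + εΠ₁ with ε ∈ (0,1) and P(Π₁ = 0) = 0, let Z be standard normal independent of Π, and let 0 < τ* < τ. Consider testing H₀ : Π = 0 given the observation X̃ = Π + τZ (respectively X̃* = Π + τ*Z). For σ > 0 let d_σ denote the density of Π + σZ and d_{0,σ}(x) = σ⁻¹φ(x/σ) the null density, and define the lfdr test at level t as rejecting when (1−ε)·d_{0,σ}(X̃)/d_σ(X̃) ≤ t; write FPR(t) = P(reject | Π = 0) and TPR(t) = P(reject | Π ≠ 0) for sigma = τ, and FPR*(t̃*), TPR*(t̃*) for the analogous quantities based on X̃*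 (σ = τ*). If thresholds t and t̃* are such that TPR(t) = TPR*(t̃*), then FPR*(t̃*) ≤ FPR(t). (In words: the lfdr test based on the less noisy observation Π + τ*Z has smaller type I error than the lfdr test based on Π + τZ at the same power.) -/
open MeasureTheory ProbabilityTheory Filter Set
open scoped Classical ENNReal NNReal Topology

noncomputable section

/-- The null density of `Π + σZ` given `Π = 0`, i.e. the density of `σZ`. -/
def nullDens (σv x : ℝ) : ℝ := σv⁻¹ * stdPhi (x / σv)

/-- The marginal (mixture) density of `Π + σZ` where `Π = (1-ε)δ₀ + εΠ₁`. -/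
def mixDens (eps : ℝ) (Pi1 : Measure ℝ) (σv x : ℝ) : ℝ :=
  (1 - eps) * nullDens σv x + eps * ∫ u, σv⁻¹ * stdPhi ((x - u) / σv) ∂Pi1

/-- The local false discovery rate of the observation `x` from `Π + σZ`. -/
def lfdrFun (eps : ℝ) (Pi1 : Measure ℝ) (σv x : ℝ) : ℝ :=
  (1 - eps) * nullDens σv x / mixDens eps Pi1 σv x

/-- Type I error (false positive rate) of the lfdr test at level `t`,
based on the observation `Π + σZ`, given `Π = 0`. -/
def FPR (eps : ℝ) (Pi1 : Measure ℝ) (σv t : ℝ) : ℝ :=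
  ((gaussianReal 0 1) {z : ℝ | lfdrFun eps Pi1 σv (σv * z) ≤ t}).toReal

/-- Power (true positive rate) of the lfdr test at level `t`,
based on the observation `Π + σZ`, given `Π ≠ 0` (so `Π ~ Π₁`). -/
def TPR (eps : ℝ) (Pi1 : Measure ℝ) (σv t : ℝ) : ℝ :=
  ((Pi1.prod (gaussianReal 0 1))
    {w : ℝ × ℝ | lfdrFun eps Pi1 σv (w.1 + σv * w.2) ≤ t}).toReal

lemma inv_mul_stdPhi_eq_gaussianPDFReal {σ : ℝ} (hσ : 0 < σ) (u x : ℝ) :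
    σ⁻¹ * stdPhi ((x - u) / σ) = gaussianPDFReal u (σ ^ 2).toNNReal x := by
  rw [gaussianPDFReal, stdPhi, Real.coe_toNNReal _ (sq_nonneg σ),
    Real.sqrt_mul (by positivity) (σ ^ 2), Real.sqrt_sq hσ.le, mul_inv, ← mul_assoc,
    mul_comm σ⁻¹]
  congr 2
  field_simp

lemma toNNReal_sq_ne_zero {σ : ℝ} (hσ : 0 < σ) : (σ ^ 2).toNNReal ≠ 0 :=
  (Real.toNNReal_pos.2 (pow_pos hσ 2)).ne'

lemma nullDens_eq_gaussianPDFReal {σ : ℝ} (hσ : 0 < σ) (x : ℝ) :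
    nullDens σ x = gaussianPDFReal 0 (σ ^ 2).toNNReal x := by
  simpa [nullDens] using inv_mul_stdPhi_eq_gaussianPDFReal hσ 0 x

/-- The density of `Π₁ + σZ`. -/
def altDens (Pi1 : Measure ℝ) (σ x : ℝ) : ℝ :=
  ∫ u, gaussianPDFReal u (σ ^ 2).toNNReal x ∂Pi1

lemma mixDens_eq {σ : ℝ} (hσ : 0 < σ) (eps : ℝ) (Pi1 : Measure ℝ) (x : ℝ) :
    mixDens eps Pi1 σ x = (1 - eps) * nullDens σ x + eps * altDens Pi1 σ x := by
  simp only [mixDens, altDens, inv_mul_stdPhi_eq_gaussianPDFReal hσ]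

lemma measurable_nullDens {σ : ℝ} (hσ : 0 < σ) : Measurable (nullDens σ) := by
  rw [funext (nullDens_eq_gaussianPDFReal hσ)]
  exact measurable_gaussianPDFReal _ _

lemma nullDens_pos {σ : ℝ} (hσ : 0 < σ) (x : ℝ) : 0 < nullDens σ x := by
  rw [nullDens_eq_gaussianPDFReal hσ]
  exact gaussianPDFReal_pos _ _ _ (toNNReal_sq_ne_zero hσ)

lemma measurable_altDens (Pi1 : Measure ℝ) [SFinite Pi1] (σ : ℝ) :
    Measurable (altDens Pi1 σ) := by
  have h : StronglyMeasurable
      (Function.uncurry fun x u : ℝ => gaussianPDFReal u (σ ^ 2).toNNReal x) :=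
    (show Measurable fun p : ℝ × ℝ => gaussianPDFReal p.2 (σ ^ 2).toNNReal p.1 by
      fun_prop).stronglyMeasurable
  exact h.integral_prod_right.measurable

lemma integrable_gaussianPDFReal_mean (Pi1 : Measure ℝ) [IsFiniteMeasure Pi1]
    (v : ℝ≥0) (x : ℝ) : Integrable (fun u => gaussianPDFReal u v x) Pi1 := by
  refine Integrable.of_bound
    (show Measurable fun u => gaussianPDFReal u v x by fun_prop).aestronglyMeasurable
    (√(2 * Real.pi * v))⁻¹ (ae_of_all _ fun u => ?_)
  rw [Real.norm_of_nonneg (gaussianPDFReal_nonneg _ _ _), gaussianPDFReal]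
  refine mul_le_of_le_one_right (by positivity) (Real.exp_le_one_iff.2 ?_)
  exact div_nonpos_of_nonpos_of_nonneg (neg_nonpos.2 (sq_nonneg _)) (by positivity)

lemma altDens_pos (Pi1 : Measure ℝ) [IsProbabilityMeasure Pi1] {σ : ℝ} (hσ : 0 < σ) (x : ℝ) :
    0 < altDens Pi1 σ x := by
  have hpos (u : ℝ) : 0 < gaussianPDFReal u (σ ^ 2).toNNReal x :=
    gaussianPDFReal_pos _ _ _ (toNNReal_sq_ne_zero hσ)
  refine (integral_pos_iff_support_of_nonneg (fun u => (hpos u).le)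
    (integrable_gaussianPDFReal_mean Pi1 _ x)).2 ?_
  rw [Function.support_eq_univ fun u => (hpos u).ne', measure_univ]
  exact one_pos

lemma withDensity_nullDens {σ : ℝ} (hσ : 0 < σ) :
    volume.withDensity (fun x => ENNReal.ofReal (nullDens σ x)) =
      gaussianReal 0 (σ ^ 2).toNNReal := by
  rw [gaussianReal_of_var_ne_zero _ (toNNReal_sq_ne_zero hσ)]
  simp only [nullDens_eq_gaussianPDFReal hσ, gaussianPDF_def]

lemma withDensity_altDens (Pi1 : Measure ℝ) [IsFiniteMeasure Pi1] {σ : ℝ} (hσ : 0 < σ) :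
    volume.withDensity (fun x => ENNReal.ofReal (altDens Pi1 σ x)) =
      Pi1 ∗ gaussianReal 0 (σ ^ 2).toNNReal := by
  have hv := toNNReal_sq_ne_zero hσ
  refine Measure.ext fun s hs => ?_
  rw [withDensity_apply _ hs, ← lintegral_indicator_one hs,
    Measure.lintegral_conv (measurable_one.indicator hs)]
  have hshift (u : ℝ) : ∫⁻ y, s.indicator 1 (u + y) ∂gaussianReal 0 (σ ^ 2).toNNReal =
      ∫⁻ x in s, gaussianPDF u (σ ^ 2).toNNReal x := by
    rw [← lintegral_map (measurable_one.indicator hs) (measurable_const_add u),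
      gaussianReal_map_const_add, zero_add, lintegral_indicator_one hs, gaussianReal_apply _ hv]
  simp only [hshift]
  rw [lintegral_lintegral_swap
    (show Measurable fun p : ℝ × ℝ => gaussianPDF p.1 (σ ^ 2).toNNReal p.2 by
      fun_prop).aemeasurable]
  refine lintegral_congr fun x => ?_
  rw [altDens, ofReal_integral_eq_lintegral_ofReal (integrable_gaussianPDFReal_mean Pi1 _ x)
    (ae_of_all _ fun u => gaussianPDFReal_nonneg _ _ _)]
  rfl

lemma measurable_lfdrFun (eps : ℝ) (Pi1 : Measure ℝ) [SFinite Pi1] {σ : ℝ} (hσ : 0 < σ) :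
    Measurable (lfdrFun eps Pi1 σ) := by
  have h0 := measurable_nullDens hσ
  have h1 := measurable_altDens Pi1 σ
  have h : lfdrFun eps Pi1 σ = fun x => (1 - eps) * nullDens σ x /
      ((1 - eps) * nullDens σ x + eps * altDens Pi1 σ x) := by
    funext x
    rw [lfdrFun, mixDens_eq hσ]
  rw [h]
  fun_prop

lemma mixDens_pos {eps : ℝ} (heps : eps ∈ Ioo (0 : ℝ) 1) (Pi1 : Measure ℝ)
    [IsProbabilityMeasure Pi1] {σ : ℝ} (hσ : 0 < σ) (x : ℝ) : 0 < mixDens eps Pi1 σ x := by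
  rw [mixDens_eq hσ]
  exact add_pos (mul_pos (sub_pos.2 heps.2) (nullDens_pos hσ x))
    (mul_pos heps.1 (altDens_pos Pi1 hσ x))

lemma lfdrFun_pos {eps : ℝ} (heps : eps ∈ Ioo (0 : ℝ) 1) (Pi1 : Measure ℝ)
    [IsProbabilityMeasure Pi1] {σ : ℝ} (hσ : 0 < σ) (x : ℝ) : 0 < lfdrFun eps Pi1 σ x :=
  div_pos (mul_pos (sub_pos.2 heps.2) (nullDens_pos hσ x)) (mixDens_pos heps Pi1 hσ x)

lemma lfdrFun_lt_one {eps : ℝ} (heps : eps ∈ Ioo (0 : ℝ) 1) (Pi1 : Measure ℝ)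
    [IsProbabilityMeasure Pi1] {σ : ℝ} (hσ : 0 < σ) (x : ℝ) : lfdrFun eps Pi1 σ x < 1 := by
  rw [lfdrFun, div_lt_one (mixDens_pos heps Pi1 hσ x), mixDens_eq hσ]
  linarith [mul_pos heps.1 (altDens_pos Pi1 hσ x)]

lemma lfdrFun_le_iff {eps : ℝ} (heps : eps ∈ Ioo (0 : ℝ) 1) (Pi1 : Measure ℝ)
    [IsProbabilityMeasure Pi1] {σ : ℝ} (hσ : 0 < σ) (t x : ℝ) :
    lfdrFun eps Pi1 σ x ≤ t ↔
      (1 - t) * (1 - eps) * nullDens σ x ≤ t * eps * altDens Pi1 σ x := by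
  rw [lfdrFun, div_le_iff₀ (mixDens_pos heps Pi1 hσ x), mixDens_eq hσ]
  constructor <;> intro h <;> linarith

lemma gaussianReal_map_mul_std (σ : ℝ) :
    (gaussianReal 0 1).map (fun z => σ * z) = gaussianReal 0 (σ ^ 2).toNNReal := by
  rw [gaussianReal_map_const_mul, mul_zero, mul_one]
  congr 1
  exact NNReal.eq (Real.coe_toNNReal _ (sq_nonneg σ)).symm

lemma FPR_eq_measureReal (eps : ℝ) (Pi1 : Measure ℝ) [SFinite Pi1] {σ : ℝ} (hσ : 0 < σ)
    (t : ℝ) : FPR eps Pi1 σ t =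
      (gaussianReal 0 (σ ^ 2).toNNReal).real {x | lfdrFun eps Pi1 σ x ≤ t} := by
  rw [← gaussianReal_map_mul_std, measureReal_def, Measure.map_apply (measurable_const_mul σ)
    (measurableSet_le (measurable_lfdrFun eps Pi1 hσ) measurable_const)]
  rfl

lemma TPR_eq_measureReal (eps : ℝ) (Pi1 : Measure ℝ) [SFinite Pi1] {σ : ℝ} (hσ : 0 < σ)
    (t : ℝ) : TPR eps Pi1 σ t =
      (Pi1 ∗ gaussianReal 0 (σ ^ 2).toNNReal).real {x | lfdrFun eps Pi1 σ x ≤ t} := by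
  have hS : MeasurableSet {x | lfdrFun eps Pi1 σ x ≤ t} :=
    measurableSet_le (measurable_lfdrFun eps Pi1 hσ) measurable_const
  have hprod : Pi1.prod (gaussianReal 0 (σ ^ 2).toNNReal) =
      (Pi1.prod (gaussianReal 0 1)).map (Prod.map id fun z => σ * z) := by
    rw [← gaussianReal_map_mul_std, ← Measure.map_prod_map _ _ measurable_id
      (measurable_const_mul σ), Measure.map_id]
  rw [measureReal_def, Measure.conv, hprod, Measure.map_map measurable_add (by fun_prop),
    Measure.map_apply (by fun_prop) hS]
  rfl

lemma measurable_measureReal_preimage_add (ν : Measure ℝ) [SFinite ν] {s : Set ℝ}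
    (hs : MeasurableSet s) : Measurable fun x => ν.real ((x + ·) ⁻¹' s) :=
  (measurable_measure_prodMk_left (measurable_add hs)).ennreal_toReal

lemma measureReal_conv_eq_integral (μ ν : Measure ℝ) [IsFiniteMeasure ν]
    {s : Set ℝ} (hs : MeasurableSet s) :
    (μ ∗ ν).real s = ∫ x, ν.real ((x + ·) ⁻¹' s) ∂μ := by
  have hm : Measurable fun x => ν ((x + ·) ⁻¹' s) :=
    measurable_measure_prodMk_left (measurable_add hs)
  simp only [measureReal_def]
  rw [integral_toReal hm.aemeasurable (ae_of_all _ fun _ => measure_lt_top _ _),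
    Measure.conv, Measure.map_apply measurable_add hs, Measure.prod_apply (measurable_add hs)]
  rfl

/-- The Neyman–Pearson lemma: a likelihood ratio test with region `R` maximizes the difference of
weighted power and weighted level among all randomized tests `ψ`. -/
lemma neyman_pearson {α : Type*} [MeasurableSpace α] (μ : Measure α) {f₀ f₁ ψ : α → ℝ}
    (hf₀ : Measurable f₀) (hf₁ : Measurable f₁) (hf₀_nonneg : ∀ x, 0 ≤ f₀ x)
    (hf₁_nonneg : ∀ x, 0 ≤ f₁ x)
    [IsFiniteMeasure (μ.withDensity fun x => ENNReal.ofReal (f₀ x))]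
    [IsFiniteMeasure (μ.withDensity fun x => ENNReal.ofReal (f₁ x))]
    (hψ : Measurable ψ) (hψ_mem : ∀ x, ψ x ∈ Icc (0 : ℝ) 1) {R : Set α} (hR : MeasurableSet R)
    {c₀ c₁ : ℝ} (hR_iff : ∀ x, x ∈ R ↔ c₀ * f₀ x ≤ c₁ * f₁ x) :
    c₀ * ((μ.withDensity fun x => ENNReal.ofReal (f₀ x)).real R -
        ∫ x, ψ x ∂μ.withDensity fun x => ENNReal.ofReal (f₀ x)) ≤
      c₁ * ((μ.withDensity fun x => ENNReal.ofReal (f₁ x)).real R -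
        ∫ x, ψ x ∂μ.withDensity fun x => ENNReal.ofReal (f₁ x)) := by
  have key {f : α → ℝ} (hf : Measurable f) (hf_nonneg : ∀ x, 0 ≤ f x)
      [IsFiniteMeasure (μ.withDensity fun x => ENNReal.ofReal (f x))] :
      Integrable (fun x => f x * (R.indicator 1 x - ψ x)) μ ∧
      (μ.withDensity fun x => ENNReal.ofReal (f x)).real R -
        ∫ x, ψ x ∂μ.withDensity (fun x => ENNReal.ofReal (f x)) =
        ∫ x, f x * (R.indicator 1 x - ψ x) ∂μ := by
    have hψi : Integrable ψ (μ.withDensity fun x => ENNReal.ofReal (f x)) :=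
      Integrable.of_bound hψ.aestronglyMeasurable 1 (ae_of_all _ fun x => by
        rw [Real.norm_of_nonneg (hψ_mem x).1]
        exact (hψ_mem x).2)
    have hRi : Integrable (R.indicator (1 : α → ℝ))
        (μ.withDensity fun x => ENNReal.ofReal (f x)) :=
      (integrable_const (1 : ℝ)).indicator hR
    constructor
    · have h := (integrable_withDensity_iff hf.ennreal_ofReal
        (ae_of_all _ fun _ => ENNReal.ofReal_lt_top)).1 (hRi.sub hψi)
      refine h.congr (ae_of_all _ fun x => ?_)
      simp [ENNReal.toReal_ofReal (hf_nonneg x), mul_comm]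
    · rw [← integral_indicator_one hR, ← integral_sub hRi hψi,
        integral_withDensity_eq_integral_toReal_smul hf.ennreal_ofReal
          (ae_of_all _ fun _ => ENNReal.ofReal_lt_top)]
      simp only [ENNReal.toReal_ofReal (hf_nonneg _), smul_eq_mul]
  obtain ⟨hi₀, he₀⟩ := key hf₀ hf₀_nonneg
  obtain ⟨hi₁, he₁⟩ := key hf₁ hf₁_nonneg
  rw [he₀, he₁, ← integral_const_mul, ← integral_const_mul]
  refine integral_mono (hi₀.const_mul c₀) (hi₁.const_mul c₁) fun x => ?_
  obtain ⟨h0, h1⟩ := hψ_mem x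
  by_cases hx : x ∈ R
  · have := mul_le_mul_of_nonneg_right ((hR_iff x).1 hx) (sub_nonneg.2 h1)
    simp only [indicator_of_mem hx, Pi.one_apply]
    linarith
  · have := mul_le_mul_of_nonneg_right (not_le.1 (mt (hR_iff x).2 hx)).le h0
    simp only [indicator_of_notMem hx]
    linarith

lemma gaussianReal_conv_of_lt {τstar τ : ℝ} (hτstar : 0 < τstar) (hττ : τstar < τ) :
    gaussianReal 0 (τstar ^ 2).toNNReal ∗ gaussianReal 0 (τ ^ 2 - τstar ^ 2).toNNReal =
      gaussianReal 0 (τ ^ 2).toNNReal := by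
  have h : 0 ≤ τ ^ 2 - τstar ^ 2 := sub_nonneg.2 (pow_le_pow_left₀ hτstar.le hττ.le 2)
  rw [gaussianReal_conv_gaussianReal, add_zero, ← Real.toNNReal_add (sq_nonneg _) h,
    add_sub_cancel]

/-- **Proposition A.13 (less noise dominates for lfdr tests).** For testing
`H₀ : Π = 0` from `X̃ = Π + τZ` vs. `X̃* = Π + τ*Z` with `0 < τ* < τ`: if the two
lfdr tests are calibrated to the same power, the one based on the less noisy
observation has the smaller type I error. -/
theorem lfdr_test_noise_monotone
    (eps : ℝ) (heps : eps ∈ Set.Ioo (0 : ℝ) 1)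
    (Pi1 : Measure ℝ) [IsProbabilityMeasure Pi1] (hPi1zero : Pi1 {0} = 0)
    (τstar τ : ℝ) (hτstar : 0 < τstar) (hττ : τstar < τ)
    (t tstar : ℝ)
    (hsame : TPR eps Pi1 τ t = TPR eps Pi1 τstar tstar) :
    FPR eps Pi1 τstar tstar ≤ FPR eps Pi1 τ t := by
  have hτ : 0 < τ := hτstar.trans hττ
  rcases le_or_gt tstar 0 with ht0 | ht0
  · have hempty : {x | lfdrFun eps Pi1 τstar x ≤ tstar} = ∅ :=
      eq_empty_of_forall_notMem fun x hx =>
        (lfdrFun_pos heps Pi1 hτstar x).not_ge (le_trans hx ht0)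
    rw [FPR_eq_measureReal eps Pi1 hτstar, hempty, measureReal_empty]
    exact ENNReal.toReal_nonneg
  rw [FPR_eq_measureReal eps Pi1 hτstar, FPR_eq_measureReal eps Pi1 hτ]
  rw [TPR_eq_measureReal eps Pi1 hτstar, TPR_eq_measureReal eps Pi1 hτ] at hsame
  have hR := measurableSet_le (measurable_lfdrFun eps Pi1 hτ) (measurable_const (a := t))
  have hRstar := measurableSet_le (measurable_lfdrFun eps Pi1 hτstar)
    (measurable_const (a := tstar))
  rcases le_or_gt 1 tstar with ht1 | ht1
  · have huniv : {x | lfdrFun eps Pi1 τstar x ≤ tstar} = univ :=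
      eq_univ_of_forall fun x => (lfdrFun_lt_one heps Pi1 hτstar x).le.trans ht1
    rw [huniv, probReal_univ] at hsame ⊢
    have hnull : (Pi1 ∗ gaussianReal 0 (τ ^ 2).toNNReal) {x | lfdrFun eps Pi1 τ x ≤ t}ᶜ = 0 := by
      rw [← measureReal_eq_zero_iff, probReal_compl_eq_one_sub hR, hsame, sub_self]
    rw [← withDensity_altDens Pi1 hτ] at hnull
    have hvol : volume {x | lfdrFun eps Pi1 τ x ≤ t}ᶜ = 0 :=
      withDensity_absolutelyContinuous' (measurable_altDens Pi1 τ).ennreal_ofReal.aemeasurable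
        (ae_of_all _ fun x => (ENNReal.ofReal_pos.2 (altDens_pos Pi1 hτ x)).ne') hnull
    have hgauss := gaussianReal_absolutelyContinuous 0 (toNNReal_sq_ne_zero hτ) hvol
    rw [← measureReal_eq_zero_iff, probReal_compl_eq_one_sub hR] at hgauss
    linarith
  set s := (τ ^ 2 - τstar ^ 2).toNNReal
  have h0 := withDensity_nullDens hτstar
  have h1 := withDensity_altDens Pi1 hτstar
  have : IsFiniteMeasure (volume.withDensity fun x => ENNReal.ofReal (nullDens τstar x)) := by
    rw [h0]; infer_instance
  have : IsFiniteMeasure (volume.withDensity fun x => ENNReal.ofReal (altDens Pi1 τstar x)) := by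
    rw [h1]; infer_instance
  have hnp := neyman_pearson volume (measurable_nullDens hτstar) (measurable_altDens Pi1 τstar)
    (fun x => (nullDens_pos hτstar x).le) (fun x => (altDens_pos Pi1 hτstar x).le)
    (measurable_measureReal_preimage_add (gaussianReal 0 s) hR)
    (fun x => ⟨measureReal_nonneg, measureReal_le_one⟩) hRstar
    (lfdrFun_le_iff heps Pi1 hτstar tstar)
  rw [h0, h1, ← measureReal_conv_eq_integral _ _ hR, ← measureReal_conv_eq_integral _ _ hR,
    Measure.conv_assoc, gaussianReal_conv_of_lt hτstar hττ, ← hsame, sub_self, mul_zero] at hnp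
  exact sub_nonpos.1 (nonpos_of_mul_nonpos_right hnp
    (mul_pos (sub_pos.2 ht1) (sub_pos.2 heps.2)))

end
end
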